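/- Let U be a real N×r matrix with orthonormal columns (UᵀU = I_r), let Λ̂ be an r×r diagonal matrix with nonnegative diagonal entries λ̂₁ ≥ … ≥ λ̂_r ≥ 0, and let μ > 0. Define P = (1/(λ̂_r + μ)) · U(Λ̂ + μI_r)Uᵀ + (I_N − UUᵀ) and Q = (λ̂_r + μ) · U(Λ̂ + μI_r)^{−1}Uᵀ + (I_N − UUᵀ). Then P is symmetric positive definite and PQ = QP = I_N; that is, Q = P^{−1}. -/

import Mathlib

open Matrix

section OrthonormalColumns

variable {m n : Type*} [DecidableEq m] [Fintype n] [DecidableEq n]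

/-- The matrix acting as `diagonal d` in the basis of columns of `U`, and as the identity on the
orthogonal complement of their span (when these columns are orthonormal). -/
def diagonalOnColumns (U : Matrix m n ℝ) (d : n → ℝ) : Matrix m m ℝ :=
  U * diagonal d * Uᵀ + (1 - U * Uᵀ)

theorem smul_add_eq_diagonalOnColumns (U : Matrix m n ℝ) (c : ℝ) (d : n → ℝ) :
    c • (U * diagonal d * Uᵀ) + (1 - U * Uᵀ) = diagonalOnColumns U (c • d) := by
  rw [diagonalOnColumns, diagonal_smul, Matrix.mul_smul, Matrix.smul_mul]

theorem diagonalOnColumns_one (U : Matrix m n ℝ) : diagonalOnColumns U 1 = 1 := by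
  simp [diagonalOnColumns]

theorem diagonalOnColumns_isHermitian (U : Matrix m n ℝ) (d : n → ℝ) :
    (diagonalOnColumns U d).IsHermitian := by
  simp [diagonalOnColumns, IsHermitian, conjTranspose_eq_transpose_of_trivial, Matrix.mul_assoc]

variable [Fintype m]

theorem diagonalOnColumns_mul {U : Matrix m n ℝ} (hU : Uᵀ * U = 1) (d e : n → ℝ) :
    diagonalOnColumns U d * diagonalOnColumns U e = diagonalOnColumns U (d * e) := by
  have hU' (A : Matrix n m ℝ) : Uᵀ * (U * A) = A := by
    rw [← Matrix.mul_assoc, hU, Matrix.one_mul]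
  have hde : diagonal (d * e) = diagonal d * diagonal e := (diagonal_mul_diagonal d e).symm
  simp only [diagonalOnColumns, hde, Matrix.mul_add, Matrix.add_mul, Matrix.mul_sub,
    Matrix.sub_mul, Matrix.mul_one, Matrix.one_mul, Matrix.mul_assoc, hU']
  abel

theorem diagonalOnColumns_mul_eq_one {U : Matrix m n ℝ} (hU : Uᵀ * U = 1) {d e : n → ℝ}
    (hde : d * e = 1) : diagonalOnColumns U d * diagonalOnColumns U e = 1 := by
  rw [diagonalOnColumns_mul hU, hde, diagonalOnColumns_one]

theorem diagonalOnColumns_posDef {U : Matrix m n ℝ} (hU : Uᵀ * U = 1) {d : n → ℝ}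
    (hd : ∀ j, 0 < d j) : (diagonalOnColumns U d).PosDef := by
  set s : n → ℝ := fun j => √(d j)
  have hs : s⁻¹ * s = 1 := by
    ext j
    exact inv_mul_cancel₀ (Real.sqrt_pos.2 (hd j)).ne'
  have hsd : d = s * s := by
    ext j
    exact (Real.mul_self_sqrt (hd j).le).symm
  have hinj : Function.Injective (diagonalOnColumns U s).mulVec :=
    Function.LeftInverse.injective (g := (diagonalOnColumns U s⁻¹).mulVec) fun v => by
      rw [mulVec_mulVec, diagonalOnColumns_mul_eq_one hU hs, one_mulVec]
  have h := PosDef.conjTranspose_mul_self _ hinj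
  rwa [(diagonalOnColumns_isHermitian U s).eq, diagonalOnColumns_mul hU, ← hsd] at h

end OrthonormalColumns

/-- The Nyström preconditioner `P = (1/(λ̂_r + μ)) U(Λ̂ + μI)Uᵀ + (I - UUᵀ)` built from a
rank-`r` approximation `Ĥ = UΛ̂Uᵀ` is symmetric positive definite, and its inverse is
`Q = (λ̂_r + μ) U(Λ̂ + μI)⁻¹Uᵀ + (I - UUᵀ)`. -/
theorem nystrom_preconditioner_posdef_and_inverse
    {N r : ℕ} (hr : 0 < r)
    (U : Matrix (Fin N) (Fin r) ℝ) (hU : Uᵀ * U = 1)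
    (l : Fin r → ℝ) (hl : Antitone l) (hl0 : ∀ j, 0 ≤ l j)
    (μ : ℝ) (hμ : 0 < μ) :
    ((1 / (l ⟨r - 1, Nat.sub_lt hr Nat.one_pos⟩ + μ)) •
        (U * Matrix.diagonal (fun j => l j + μ) * Uᵀ) + (1 - U * Uᵀ)).PosDef ∧
    ((1 / (l ⟨r - 1, Nat.sub_lt hr Nat.one_pos⟩ + μ)) •
        (U * Matrix.diagonal (fun j => l j + μ) * Uᵀ) + (1 - U * Uᵀ)) *
      ((l ⟨r - 1, Nat.sub_lt hr Nat.one_pos⟩ + μ) •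
        (U * Matrix.diagonal (fun j => (l j + μ)⁻¹) * Uᵀ) + (1 - U * Uᵀ)) = 1 ∧
    ((l ⟨r - 1, Nat.sub_lt hr Nat.one_pos⟩ + μ) •
        (U * Matrix.diagonal (fun j => (l j + μ)⁻¹) * Uᵀ) + (1 - U * Uᵀ)) *
      ((1 / (l ⟨r - 1, Nat.sub_lt hr Nat.one_pos⟩ + μ)) •
        (U * Matrix.diagonal (fun j => l j + μ) * Uᵀ) + (1 - U * Uᵀ)) = 1 := by
  have hpos (j : Fin r) : 0 < l j + μ := add_pos_of_nonneg_of_pos (hl0 j) hμ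
  have hc := hpos ⟨r - 1, Nat.sub_lt hr Nat.one_pos⟩
  simp only [smul_add_eq_diagonalOnColumns]
  refine ⟨diagonalOnColumns_posDef hU fun j => mul_pos (one_div_pos.2 hc) (hpos j),
    diagonalOnColumns_mul_eq_one hU ?_, diagonalOnColumns_mul_eq_one hU ?_⟩ <;>
  · ext j
    have hj := (hpos j).ne'
    have hc' := hc.ne'
    simp only [Pi.mul_apply, Pi.smul_apply, smul_eq_mul, Pi.one_apply]
    field_simp
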